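/- Let T be the Gauss map with repeller Λ = [0,1]∖ℚ and for α > 2 let ψ_α := (α/2 − 1)ψ where ψ := log|T'|. Then for all α > 2 and for every y ∈ [0,1], the Hausdorff dimension of D_y(ψ_α) equals 2/α. -/

import Mathlib

open Set Filter Topology

/-- The Gauss map `x ↦ 1/x - ⌊1/x⌋` (with `T 0 = 0`). -/
noncomputable def gaussMap : ℝ → ℝ := fun x => if x = 0 then 0 else Int.fract x⁻¹

/-- The repeller of the Gauss map: `Λ = [0,1] \ ℚ`. -/
def gaussRepeller : Set ℝ := {x ∈ Set.Icc (0:ℝ) 1 | Irrational x}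

/-- `ψ = log |T'|` for the Gauss map. -/
noncomputable def gaussPsi : ℝ → ℝ := fun x => Real.log |deriv gaussMap x|

/-- Birkhoff sum `S_n(f)(x) = ∑_{l<n} f(T^l x)` for the Gauss map. -/
noncomputable def gaussBirkhoff (f : ℝ → ℝ) (n : ℕ) (x : ℝ) : ℝ :=
  ∑ l ∈ Finset.range n, f (gaussMap^[l] x)

/-- The shrinking target set `D_y(φ)` for the Gauss map. -/
def gaussTarget (y : ℝ) (φ : ℝ → ℝ) : Set ℝ :=
  ⋂ m : ℕ, ⋃ n : ℕ, ⋃ _ : m ≤ n,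
    {x | x ∈ gaussRepeller ∧ |gaussMap^[n] x - y| < Real.exp (-(gaussBirkhoff φ n x))}

open MeasureTheory in
/-- Finitely many disjoint balls of a fine cover fill a definite proportion of an interval. -/
theorem exists_finset_disjoint_closedBall {ι : Type*} [Countable ι] {z r : ι → ℝ} {s : Set ι}
    {a b δ : ℝ} (hab : a < b) (hδ : 8 * δ ≤ b - a) (hr : ∀ i ∈ s, 0 < r i ∧ r i ≤ δ)
    (hcov : ∀ x ∈ Icc a b, Irrational x → ∃ i ∈ s, |x - z i| ≤ r i) :
    ∃ F : Finset ι, (∀ i ∈ F, i ∈ s ∧ a ≤ z i - r i ∧ z i + r i ≤ b) ∧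
      (∀ i ∈ F, ∀ j ∈ F, i ≠ j → r i + r j < |z i - z j|) ∧
      (b - a) / 20 ≤ ∑ i ∈ F, 2 * r i := by
  set t : Set ι := {i | i ∈ s ∧ a ≤ z i - r i ∧ z i + r i ≤ b} with ht
  obtain ⟨u, hut, hdis, hu⟩ := Vitali.exists_disjoint_subfamily_covering_enlargement_closedBall
    t z r δ (fun i hi => (hr i hi.1).2) 5 (by norm_num)
  have hsub : Icc (a + 2 * δ) (b - 2 * δ) \ range ((↑) : ℚ → ℝ) ⊆
      ⋃ i : u, Metric.closedBall (z i) (5 * r i) := by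
    rintro x ⟨hx, hxi⟩
    obtain ⟨j, hj, _⟩ : ∃ i ∈ s, True := by
      obtain ⟨q, hq1, hq2⟩ := exists_irrational_btwn hab
      obtain ⟨i, hi, _⟩ := hcov q ⟨hq2.1.le, hq2.2.le⟩ hq1
      exact ⟨i, hi, trivial⟩
    have hδ0 : 0 < δ := (hr j hj).1.trans_le (hr j hj).2
    obtain ⟨i, hi, hxz⟩ := hcov x ⟨by linarith [hx.1], by linarith [hx.2]⟩ hxi
    have h2 := (hr i hi).2
    have h3 := abs_le.1 hxz
    have hit : i ∈ t := ⟨hi, by linarith [hx.1], by linarith [hx.2]⟩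
    obtain ⟨k, hk, hik⟩ := hu i hit
    refine mem_iUnion.2 ⟨⟨k, hk⟩, hik ?_⟩
    rwa [Metric.mem_closedBall, Real.dist_eq]
  have hvol : ENNReal.ofReal ((b - a) / 2) ≤ ∑' i : u, ENNReal.ofReal (10 * r i) := by
    calc ENNReal.ofReal ((b - a) / 2) ≤ ENNReal.ofReal ((b - 2 * δ) - (a + 2 * δ)) :=
          ENNReal.ofReal_le_ofReal (by linarith)
      _ = volume (Icc (a + 2 * δ) (b - 2 * δ)) := Real.volume_Icc.symm
      _ = volume (Icc (a + 2 * δ) (b - 2 * δ) \ range ((↑) : ℚ → ℝ)) :=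
          (measure_sdiff_null ((countable_range _).measure_zero volume)).symm
      _ ≤ volume (⋃ i : u, Metric.closedBall (z i) (5 * r i)) := measure_mono hsub
      _ ≤ ∑' i : u, volume (Metric.closedBall (z i) (5 * r i)) := measure_iUnion_le _
      _ = _ := by
          congr 1; ext i; rw [Real.volume_closedBall]; congr 1; ring
  have hlt : ENNReal.ofReal ((b - a) / 4) < ∑' i : u, ENNReal.ofReal (10 * r i) :=
    lt_of_lt_of_le ((ENNReal.ofReal_lt_ofReal_iff (by linarith)).2 (by linarith)) hvol
  rw [ENNReal.tsum_eq_iSup_sum] at hlt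
  obtain ⟨G, hG⟩ := lt_iSup_iff.1 hlt
  have hG' : (b - a) / 4 < ∑ i ∈ G, 10 * r i := by
    rw [← ENNReal.ofReal_sum_of_nonneg
      (fun i _ => by linarith [(hr i (hut i.2).1).1])] at hG
    exact (ENNReal.ofReal_lt_ofReal_iff_of_nonneg (by linarith)).1 hG
  refine ⟨G.map ⟨Subtype.val, Subtype.val_injective⟩, ?_, ?_, ?_⟩
  · intro i hi
    simp only [Finset.mem_map, Function.Embedding.coeFn_mk] at hi
    obtain ⟨j, _, rfl⟩ := hi
    exact hut j.2
  · intro i hi j hj hij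
    simp only [Finset.mem_map, Function.Embedding.coeFn_mk] at hi hj
    obtain ⟨i, _, rfl⟩ := hi
    obtain ⟨j, _, rfl⟩ := hj
    have h1 := hdis i.2 j.2 hij
    have h2 := (hr i (hut i.2).1).1
    have h3 := (hr j (hut j.2).1).1
    have := (disjoint_closedBall_closedBall_iff h2.le h3.le).1 h1
    rwa [Real.dist_eq] at this
  · rw [Finset.sum_map]
    simp only [Function.Embedding.coeFn_mk]
    rw [← Finset.mul_sum] at hG' ⊢
    linarith

section Offsets

variable {ι : Type*}

/-- Total length of the balls of the family `F` centred to the left of `z i`. -/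
noncomputable def ballOffset (F : Finset ι) (z r : ι → ℝ) (i : ι) : ℝ :=
  ∑ j ∈ F with z j < z i, 2 * r j

theorem ballOffset_add_le {F : Finset ι} {z r : ι → ℝ} (hr : ∀ i ∈ F, 0 < r i) {i j : ι}
    (hi : i ∈ F) (hij : z i < z j) :
    ballOffset F z r i + 2 * r i ≤ ballOffset F z r j := by
  classical
  unfold ballOffset
  rw [add_comm, ← Finset.sum_insert (s := F.filter (fun k => z k < z i)) (a := i)
    (f := fun k => 2 * r k) (by simp)]
  refine Finset.sum_le_sum_of_subset_of_nonneg ?_ ?_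
  · intro k hk
    simp only [Finset.mem_insert, Finset.mem_filter] at hk ⊢
    rcases hk with rfl | hk
    · exact ⟨hi, hij⟩
    · exact ⟨hk.1, hk.2.trans hij⟩
  · intro k hk _
    linarith [hr k (Finset.mem_filter.1 hk).1]

/-- The intervals `[ballOffset i, ballOffset i + 2 r i)` tile `[0, ∑ 2 r i)`. -/
theorem exists_mem_ballOffset {F : Finset ι} {z r : ι → ℝ} (hr : ∀ i ∈ F, 0 < r i)
    (hdis : ∀ i ∈ F, ∀ j ∈ F, i ≠ j → r i + r j < |z i - z j|) {u : ℝ} (hu0 : 0 ≤ u)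
    (hu : u < ∑ j ∈ F, 2 * r j) :
    ∃ i ∈ F, ballOffset F z r i ≤ u ∧ u < ballOffset F z r i + 2 * r i := by
  classical
  have hinj : ∀ i ∈ F, ∀ j ∈ F, z i = z j → i = j := by
    intro i hi j hj h
    by_contra hne
    have := hdis i hi j hj hne
    rw [h, sub_self, abs_zero] at this
    linarith [hr i hi, hr j hj]
  have hne : F.Nonempty := by
    rw [Finset.nonempty_iff_ne_empty]
    rintro rfl
    simp at hu
    linarith
  obtain ⟨m, hm, hmin⟩ := F.exists_min_image z hne
  have hm0 : ballOffset F z r m = 0 := by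
    unfold ballOffset
    rw [Finset.filter_false_of_mem, Finset.sum_empty]
    intro k hk
    exact not_lt.2 (hmin k hk)
  obtain ⟨i, hi, himax⟩ := (F.filter fun k => ballOffset F z r k ≤ u).exists_max_image z
    ⟨m, by simp [hm, hm0, hu0]⟩
  rw [Finset.mem_filter] at hi
  refine ⟨i, hi.1, hi.2, ?_⟩
  have hsplit : ∑ k ∈ F with z k ≤ z i, 2 * r k = ballOffset F z r i + 2 * r i := by
    unfold ballOffset
    rw [add_comm, ← Finset.sum_insert (s := F.filter (fun k => z k < z i)) (a := i)
      (f := fun k => 2 * r k) (by simp)]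
    refine Finset.sum_congr ?_ fun _ _ => rfl
    ext k
    simp only [Finset.mem_insert, Finset.mem_filter]
    constructor
    · rintro ⟨hk, hle⟩
      rcases hle.lt_or_eq with h | h
      · exact Or.inr ⟨hk, h⟩
      · exact Or.inl (hinj k hk i hi.1 h)
    · rintro (rfl | ⟨hk, h⟩)
      · exact ⟨hi.1, le_rfl⟩
      · exact ⟨hk, h.le⟩
  by_contra! hcon
  by_cases hlast : ∃ k ∈ F, z i < z k
  · obtain ⟨k, hk, hkmin⟩ := (F.filter fun k => z i < z k).exists_min_image z
      (by obtain ⟨k, hk, h⟩ := hlast; exact ⟨k, by simp [hk, h]⟩)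
    rw [Finset.mem_filter] at hk
    have hck : ballOffset F z r k = ballOffset F z r i + 2 * r i := by
      rw [← hsplit]
      unfold ballOffset
      refine Finset.sum_congr ?_ fun _ _ => rfl
      ext l
      simp only [Finset.mem_filter, and_congr_right_iff]
      intro hl
      constructor
      · intro h
        by_contra! h'
        exact (hkmin l (by simp [hl, h'])).not_gt h
      · intro h
        exact h.trans_lt hk.2
    exact (himax k (by simp [hk.1, hck, hcon])).not_gt hk.2
  · push Not at hlast
    rw [Finset.filter_true_of_mem hlast] at hsplit
    linarith

open MeasureTheory in
theorem ballOffset_sub_le {F : Finset ι} {z r : ι → ℝ} (hr : ∀ i ∈ F, 0 < r i)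
    (hdis : ∀ i ∈ F, ∀ j ∈ F, i ≠ j → r i + r j < |z i - z j|) {i j : ι} (hi : i ∈ F)
    (hj : j ∈ F) (hij : z i < z j) :
    ballOffset F z r j + 2 * r j - ballOffset F z r i ≤ (z j + r j) - (z i - r i) := by
  classical
  set G := F.filter (fun k => z i ≤ z k ∧ (z k < z j ∨ k = j)) with hG
  have hsum : ballOffset F z r j + 2 * r j = ballOffset F z r i + ∑ k ∈ G, 2 * r k := by
    unfold ballOffset
    rw [add_comm, ← Finset.sum_insert (s := F.filter (fun k => z k < z j)) (a := j)
      (f := fun k => 2 * r k) (by simp), ← Finset.sum_union]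
    · refine Finset.sum_congr ?_ fun _ _ => rfl
      ext k
      simp only [hG, Finset.mem_insert, Finset.mem_filter, Finset.mem_union]
      constructor
      · rintro (rfl | ⟨hk, h⟩)
        · exact Or.inr ⟨hj, hij.le, Or.inr rfl⟩
        · rcases lt_or_ge (z k) (z i) with h' | h'
          · exact Or.inl ⟨hk, h'⟩
          · exact Or.inr ⟨hk, h', Or.inl h⟩
      · rintro (⟨hk, h⟩ | ⟨hk, _, h | h⟩)
        · exact Or.inr ⟨hk, h.trans hij⟩
        · exact Or.inr ⟨hk, h⟩
        · exact Or.inl h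
    · rw [Finset.disjoint_left]
      intro k hk hk'
      exact (Finset.mem_filter.1 hk').2.1.not_gt (Finset.mem_filter.1 hk).2
  have hsub : (⋃ k ∈ G, Metric.closedBall (z k) (r k)) ⊆ Icc (z i - r i) (z j + r j) := by
    intro x hx
    simp only [mem_iUnion] at hx
    obtain ⟨k, hk, hx⟩ := hx
    rw [Real.closedBall_eq_Icc] at hx
    simp only [hG, Finset.mem_filter] at hk
    obtain ⟨hkF, hik, hkj⟩ := hk
    constructor
    · by_cases hki : k = i
      · subst hki; exact hx.1
      · have := hdis k hkF i hi hki
        rw [abs_of_nonneg (by linarith)] at this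
        linarith [hx.1, hr i hi]
    · rcases hkj with hkj | rfl
      · have := hdis j hj k hkF (by rintro rfl; exact lt_irrefl _ hkj)
        rw [abs_of_nonneg (by linarith)] at this
        linarith [hx.2, hr j hj]
      · exact hx.2
  have hm := measure_mono (μ := volume) hsub
  rw [measure_biUnion_finset, Real.volume_Icc] at hm
  · simp only [Real.volume_closedBall] at hm
    rw [← ENNReal.ofReal_sum_of_nonneg] at hm
    · have := (ENNReal.ofReal_le_ofReal_iff
        (by linarith [hr i hi, hr j hj])).1 hm
      linarith
    · intro k hk
      linarith [hr k (Finset.mem_filter.1 hk).1]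
  · intro k hk l hl hkl
    have hk' := (Finset.mem_filter.1 hk).1
    have hl' := (Finset.mem_filter.1 hl).1
    refine Metric.closedBall_disjoint_closedBall ?_
    rw [Real.dist_eq]
    exact hdis k hk' l hl' hkl
  · intro k _
    exact Metric.isClosed_closedBall.measurableSet

end Offsets

/-- An interval `[a, b]` together with an interval `[c, d)` of parameters mapped into it. -/
structure ParamCell where
  a : ℝ
  b : ℝ
  c : ℝ
  d : ℝ

/-- A nondegenerate cell inside the unit interval whose parameter interval has length at most
`(b - a) ^ t`. -/
structure ParamCell.IsGood (t : ℝ) (S : ParamCell) : Prop where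
  nonneg : 0 ≤ S.a
  le_one : S.b ≤ 1
  lt : S.a < S.b
  length_le : S.d - S.c ≤ (S.b - S.a) ^ t

theorem exists_small_radius {w t β C ε : ℝ} (hw : 0 < w) (hC : 0 < C) (hβt : t * β < 1)
    (hε : 0 < ε) :
    ∃ δ > 0, 8 * δ ≤ w ∧ ∀ r, 0 < r → r ≤ δ →
      40 * w ^ (t - 1) * r ^ (1 - t * β) ≤ C ^ t ∧ 40 * w ^ (t - 1) * r ≤ ε := by
  have h1 : Tendsto (fun r : ℝ => 40 * w ^ (t - 1) * r ^ (1 - t * β)) (𝓝[>] 0) (𝓝 0) := by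
    have : ContinuousAt (fun r : ℝ => 40 * w ^ (t - 1) * r ^ (1 - t * β)) 0 :=
      continuousAt_const.mul (Real.continuousAt_rpow_const _ _ (Or.inr (by linarith)))
    have h := this.tendsto.mono_left (nhdsWithin_le_nhds (s := Ioi 0))
    simpa [Real.zero_rpow (sub_pos.2 hβt).ne'] using h
  have h2 : Tendsto (fun r : ℝ => 40 * w ^ (t - 1) * r) (𝓝[>] 0) (𝓝 0) := by
    have : ContinuousAt (fun r : ℝ => 40 * w ^ (t - 1) * r) 0 := by fun_prop
    have h := this.tendsto.mono_left (nhdsWithin_le_nhds (s := Ioi 0))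
    simpa using h
  have h3 := (h1.eventually (ge_mem_nhds (Real.rpow_pos_of_pos hC t))).and
    (h2.eventually (ge_mem_nhds hε))
  obtain ⟨δ, hδ, hs⟩ := mem_nhdsGT_iff_exists_Ioc_subset.1 h3
  refine ⟨min δ (w / 8), lt_min hδ (by positivity), ?_, fun r hr hrδ => ?_⟩
  · linarith [min_le_right δ (w / 8)]
  · exact hs ⟨hr, hrδ.trans (min_le_left _ _)⟩

section Ubiquity

variable {ι : Type*} [Countable ι] {z r p q : ι → ℝ} {lev : ι → ℕ} {β C t : ℝ}

theorem ParamCell.IsGood.exists_refinement (hC : 0 < C) (ht : 0 < t) (ht1 : t ≤ 1)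
    (hβt : t * β < 1) (hr : ∀ i, 0 < r i) (hp : ∀ i, z i - r i / 2 ≤ p i)
    (hq : ∀ i, q i ≤ z i + r i / 2) (hpq : ∀ i, C * r i ^ β ≤ q i - p i)
    (hcov : ∀ N : ℕ, ∀ δ > 0, ∀ x ∈ Icc (0 : ℝ) 1, Irrational x →
      ∃ i, N ≤ lev i ∧ r i ≤ δ ∧ |x - z i| ≤ r i)
    (N : ℕ) {S : ParamCell} (hS : S.IsGood t) :
    ∃ next : ℝ → ParamCell, ∀ u ∈ Ico S.c S.d, (next u).IsGood t ∧
      u ∈ Ico (next u).c (next u).d ∧ S.a ≤ (next u).a ∧ (next u).b ≤ S.b ∧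
      (∃ i, N ≤ lev i ∧ (next u).a = p i ∧ (next u).b = q i) ∧
      (next u).d - (next u).c ≤ 1 / ((N : ℝ) + 1) ∧
      ∀ v ∈ Ico S.c S.d, next u = next v ∨ ∀ x ∈ Icc (next u).a (next u).b,
        ∀ x' ∈ Icc (next v).a (next v).b, |u - v| ≤ 80 * |x - x'| ^ t := by
  have hw : 0 < S.b - S.a := sub_pos.2 hS.lt
  by_cases hcd : S.c < S.d
  swap
  · refine ⟨fun _ => S, fun u hu => ?_⟩
    exact absurd (hu.1.trans_lt hu.2) hcd
  obtain ⟨δ, hδ, hδw, hsmall⟩ := exists_small_radius (t := t) (β := β) (C := C)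
    (ε := 1 / ((N : ℝ) + 1)) hw hC hβt (by positivity)
  obtain ⟨F, hF, hdis, hV⟩ := exists_finset_disjoint_closedBall (z := z) (r := r)
    (s := {i | N ≤ lev i ∧ r i ≤ δ}) hS.lt hδw (fun i hi => ⟨hr i, hi.2⟩) (by
      intro x hx hxi
      obtain ⟨i, h1, h2, h3⟩ := hcov N δ hδ x
        ⟨hS.nonneg.trans hx.1, hx.2.trans hS.le_one⟩ hxi
      exact ⟨i, ⟨h1, h2⟩, h3⟩)
  set V := ∑ i ∈ F, 2 * r i with hVdef
  have hV0 : 0 < V := lt_of_lt_of_le (by positivity) hV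
  set κ := (S.d - S.c) / V with hκ
  have hκ0 : 0 < κ := div_pos (sub_pos.2 hcd) hV0
  have hκV : κ * V = S.d - S.c := div_mul_cancel₀ _ hV0.ne'
  have hκle : κ ≤ 20 * (S.b - S.a) ^ (t - 1) := by
    rw [hκ, div_le_iff₀ hV0]
    calc S.d - S.c ≤ (S.b - S.a) ^ t := hS.length_le
      _ = 20 * (S.b - S.a) ^ (t - 1) * ((S.b - S.a) / 20) := by
          rw [Real.rpow_sub_one hw.ne']; field_simp
      _ ≤ _ := by gcongr
  have hrF : ∀ i ∈ F, 0 < r i := fun i _ => hr i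
  have hex : ∀ u, ∃ i, u ∈ Ico S.c S.d → i ∈ F ∧ S.c + κ * ballOffset F z r i ≤ u ∧
      u < S.c + κ * (ballOffset F z r i + 2 * r i) := by
    intro u
    by_cases hu : u ∈ Ico S.c S.d
    · obtain ⟨i, hi, h1, h2⟩ := exists_mem_ballOffset (u := (u - S.c) / κ) hrF hdis
        (div_nonneg (sub_nonneg.2 hu.1) hκ0.le) (by
          rw [div_lt_iff₀ hκ0, mul_comm, ← hVdef, hκV]; linarith [hu.2])
      rw [le_div_iff₀ hκ0] at h1
      rw [div_lt_iff₀ hκ0] at h2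
      exact ⟨i, fun _ => ⟨hi, by linarith, by linarith⟩⟩
    · have : F.Nonempty := by
        rw [Finset.nonempty_iff_ne_empty]
        intro h
        simp [hVdef, h] at hV0
      exact ⟨this.choose, fun h => absurd h hu⟩
  choose idx hidx using hex
  have hsep : ∀ u ∈ Ico S.c S.d, ∀ v ∈ Ico S.c S.d, z (idx u) < z (idx v) →
      ∀ x ∈ Icc (p (idx u)) (q (idx u)), ∀ x' ∈ Icc (p (idx v)) (q (idx v)),
      |u - v| ≤ 80 * |x - x'| ^ t := by
    intro u hu v hv hij x hx x' hx'
    obtain ⟨hi, hui, hui'⟩ := hidx u hu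
    obtain ⟨hj, hvj, hvj'⟩ := hidx v hv
    set i := idx u
    set j := idx v
    have h1 := mul_le_mul_of_nonneg_left (ballOffset_add_le hrF hi hij) hκ0.le
    have h2 := mul_le_mul_of_nonneg_left (ballOffset_sub_le hrF hdis hi hj hij) hκ0.le
    have h3 := hdis i hi j hj (by intro h; rw [h] at hij; exact lt_irrefl _ hij)
    rw [abs_sub_comm, abs_of_pos (by linarith)] at h3
    have h4 : (z j - z i) / 2 ≤ x' - x := by
      linarith [hx.2, hq i, hx'.1, hp j]
    have hD : 0 < x' - x := lt_of_lt_of_le (by linarith) h4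
    have hDle : x' - x ≤ S.b - S.a := by
      linarith [hx.1, hp i, hx'.2, hq j, (hF i hi).2.1, (hF j hj).2.2, hr i, hr j]
    rw [abs_sub_comm, abs_sub_comm x, abs_of_pos hD, abs_of_nonneg (by linarith)]
    have h5 : (z j + r j) - (z i - r i) ≤ 4 * (x' - x) := by linarith
    have h6 : 0 ≤ (z j + r j) - (z i - r i) := by linarith [hr i, hr j]
    calc v - u ≤ κ * (ballOffset F z r j + 2 * r j - ballOffset F z r i) := by linarith
      _ ≤ κ * ((z j + r j) - (z i - r i)) := h2
      _ ≤ (20 * (S.b - S.a) ^ (t - 1)) * (4 * (x' - x)) := by gcongr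
      _ ≤ (20 * (x' - x) ^ (t - 1)) * (4 * (x' - x)) := by
          have := Real.rpow_le_rpow_of_nonpos hD hDle (sub_nonpos.2 ht1)
          gcongr
      _ = 80 * (x' - x) ^ t := by
          rw [Real.rpow_sub_one hD.ne']; field_simp; norm_num
  refine ⟨fun u => ⟨p (idx u), q (idx u), S.c + κ * ballOffset F z r (idx u),
    S.c + κ * (ballOffset F z r (idx u) + 2 * r (idx u))⟩, fun u hu => ?_⟩
  obtain ⟨hi, hui, hui'⟩ := hidx u hu
  set i := idx u with hidef
  obtain ⟨⟨hlev, hrδ⟩, hai, hib⟩ := hF i hi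
  obtain ⟨hs1, hs2⟩ := hsmall (r i) (hr i) hrδ
  have hpq0 : 0 < C * r i ^ β := mul_pos hC (Real.rpow_pos_of_pos (hr i) _)
  have hlen : S.c + κ * (ballOffset F z r i + 2 * r i) - (S.c + κ * ballOffset F z r i) ≤
      40 * (S.b - S.a) ^ (t - 1) * r i := by
    have := mul_le_mul_of_nonneg_right hκle (hr i).le
    linarith
  refine ⟨⟨?_, ?_, ?_, ?_⟩, ⟨hui, hui'⟩, ?_, ?_, ⟨i, hlev, rfl, rfl⟩, hlen.trans hs2, ?_⟩
  · simp only
    linarith [hp i, hr i, hS.nonneg]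
  · simp only
    linarith [hq i, hr i, hS.le_one]
  · simp only
    linarith [hpq i]
  · simp only
    calc _ ≤ 40 * (S.b - S.a) ^ (t - 1) * r i := hlen
      _ = 40 * (S.b - S.a) ^ (t - 1) * r i ^ (1 - t * β) * (r i ^ β) ^ t := by
          rw [← Real.rpow_mul (hr i).le, mul_assoc _ (r i ^ _), ← Real.rpow_add (hr i),
            show 1 - t * β + β * t = 1 by ring, Real.rpow_one]
      _ ≤ C ^ t * (r i ^ β) ^ t := by
          have := Real.rpow_nonneg (Real.rpow_nonneg (hr i).le β) t
          gcongr
      _ = (C * r i ^ β) ^ t :=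
          (Real.mul_rpow hC.le (Real.rpow_nonneg (hr i).le β)).symm
      _ ≤ (q i - p i) ^ t := Real.rpow_le_rpow hpq0.le (hpq i) ht.le
  · simp only
    linarith [hp i, hr i]
  · simp only
    linarith [hq i, hr i]
  · intro v hv
    simp only
    by_cases hij : i = idx v
    · left
      rw [← hidef, hij]
    · right
      intro x hx x' hx'
      rcases lt_trichotomy (z i) (z (idx v)) with h | h | h
      · exact hsep u hu v hv h x hx x' hx'
      · have := hdis i hi _ (hidx v hv).1 hij
        rw [h, sub_self, abs_zero] at this
        linarith [hr i, hr (idx v)]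
      · rw [abs_sub_comm, abs_sub_comm x]
        exact hsep v hv u hu h x' hx' x hx

/-- A ubiquity theorem: if almost every point lies in arbitrarily small balls `B(z i, r i)` of
arbitrarily high level, then the limsup set of intervals of length at least `C * r i ^ β` inside
these balls has dimension at least `t` whenever `t < 1 / β`. -/
theorem le_dimH_of_ubiquity (hC : 0 < C) (ht : 0 < t) (ht1 : t ≤ 1)
    (hβt : t * β < 1) (hr : ∀ i, 0 < r i) (hp : ∀ i, z i - r i / 2 ≤ p i)
    (hq : ∀ i, q i ≤ z i + r i / 2) (hpq : ∀ i, C * r i ^ β ≤ q i - p i)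
    (hcov : ∀ N : ℕ, ∀ δ > 0, ∀ x ∈ Icc (0 : ℝ) 1, Irrational x →
      ∃ i, N ≤ lev i ∧ r i ≤ δ ∧ |x - z i| ≤ r i) :
    ENNReal.ofReal t ≤ dimH {x | x ∈ Icc (0 : ℝ) 1 ∧ Irrational x ∧
      ∀ N, ∃ i, N ≤ lev i ∧ x ∈ Icc (p i) (q i)} := by
  have hstep := fun N (S : ParamCell) (hS : S.IsGood t) =>
    hS.exists_refinement hC ht ht1 hβt hr hp hq hpq hcov N
  choose! next hnext using hstep
  set cell : ℕ → ℝ → ParamCell := fun k u =>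
    Nat.rec ⟨0, 1, 0, 1⟩ (fun k S => next k S u) k with hcell
  have hcell0 : ∀ u, cell 0 u = ⟨0, 1, 0, 1⟩ := fun _ => rfl
  have hcellS : ∀ k u, cell (k + 1) u = next k (cell k u) u := fun _ _ => rfl
  have hgood : ∀ k, ∀ u ∈ Ico (0 : ℝ) 1, (cell k u).IsGood t ∧
      u ∈ Ico (cell k u).c (cell k u).d := by
    intro k u hu
    induction k with
    | zero =>
      rw [hcell0]
      exact ⟨⟨le_rfl, le_rfl, one_pos, by simp⟩, hu⟩
    | succ k ih =>
      rw [hcellS]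
      obtain ⟨h1, h2, -⟩ := hnext k (cell k u) ih.1 u ih.2
      exact ⟨h1, h2⟩
  have hanti : ∀ u ∈ Ico (0 : ℝ) 1, Antitone fun k => Icc (cell k u).a (cell k u).b := by
    intro u hu
    refine antitone_nat_of_succ_le fun k => ?_
    obtain ⟨-, -, h3, h4, -⟩ := hnext k (cell k u) (hgood k u hu).1 u (hgood k u hu).2
    rw [hcellS]
    exact Icc_subset_Icc h3 h4
  have hpt : ∀ u, ∃ x, u ∈ Ico (0 : ℝ) 1 → ∀ k, x ∈ Icc (cell k u).a (cell k u).b := by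
    intro u
    by_cases hu : u ∈ Ico (0 : ℝ) 1
    · obtain ⟨x, hx⟩ := IsCompact.nonempty_iInter_of_sequence_nonempty_isCompact_isClosed
        (fun k => Icc (cell k u).a (cell k u).b) (fun k => hanti u hu k.le_succ)
        (fun k => nonempty_Icc.2 (hgood k u hu).1.lt.le) isCompact_Icc
        (fun k => isClosed_Icc)
      exact ⟨x, fun _ => mem_iInter.1 hx⟩
    · exact ⟨0, fun h => absurd h hu⟩
  choose h hh using hpt
  have hholder : ∀ u ∈ Ico (0 : ℝ) 1, ∀ v ∈ Ico (0 : ℝ) 1,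
      |u - v| ≤ 80 * |h u - h v| ^ t := by
    intro u hu v hv
    by_cases hall : ∀ k, cell k u = cell k v
    · have : |u - v| ≤ 0 := by
        refine ge_of_tendsto tendsto_one_div_add_atTop_nhds_zero_nat
          (Eventually.of_forall fun k => ?_)
        obtain ⟨-, h2, -, -, -, h6, -⟩ :=
          hnext k (cell k u) (hgood k u hu).1 u (hgood k u hu).2
        rw [← hcellS] at h2 h6
        have h7 := (hgood (k + 1) v hv).2
        rw [← hall (k + 1)] at h7
        rw [abs_le]
        constructor <;> linarith [h2.1, h2.2, h7.1, h7.2]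
      exact this.trans (by positivity)
    · push Not at hall
      classical
      have hk := Nat.find_spec hall
      obtain ⟨k, hk'⟩ : ∃ k, Nat.find hall = k + 1 := by
        refine Nat.exists_eq_succ_of_ne_zero fun h0 => ?_
        rw [h0] at hk
        exact hk rfl
      have hkeq : cell k u = cell k v := by
        by_contra hne
        exact Nat.find_min hall (by omega) hne
      rw [hk'] at hk
      obtain ⟨-, -, -, -, -, -, h7⟩ :=
        hnext k (cell k u) (hgood k u hu).1 u (hgood k u hu).2
      have hvk := (hgood k v hv).2
      rw [← hkeq] at hvk
      have hxu := hh u hu (k + 1)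
      have hxv := hh v hv (k + 1)
      rw [hcellS] at hxu hxv hk
      rw [hcellS, ← hkeq] at hk
      rw [← hkeq] at hxv
      exact (h7 v hvk).resolve_left hk _ hxu _ hxv
  have hinj : InjOn h (Ico 0 1) := by
    intro u hu v hv huv
    have := hholder u hu v hv
    rw [huv, sub_self, abs_zero, Real.zero_rpow ht.ne', mul_zero] at this
    exact sub_eq_zero.1 (abs_nonpos_iff.1 this)
  set A := {u ∈ Ico (0 : ℝ) 1 | Irrational (h u)} with hA
  have hAsub : A ⊆ Ico 0 1 := fun u hu => hu.1
  have hAdim : dimH A = 1 := by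
    have hcount : (Ico (0 : ℝ) 1 \ A).Countable := by
      refine MapsTo.countable_of_injOn (t := range ((↑) : ℚ → ℝ)) (f := h) ?_
        (hinj.mono sdiff_subset) (countable_range _)
      intro u hu
      by_contra hcon
      exact hu.2 ⟨hu.1, hcon⟩
    have h1 : dimH (Ico (0 : ℝ) 1) = 1 := by
      rw [Real.dimH_of_nonempty_interior]
      · simp
      · rw [interior_Ico]
        exact nonempty_Ioo.2 one_pos
    rw [← sdiff_union_of_subset hAsub, dimH_union, dimH_countable hcount] at h1
    simpa using h1
  have hsub : h '' A ⊆ {x | x ∈ Icc (0 : ℝ) 1 ∧ Irrational x ∧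
      ∀ N, ∃ i, N ≤ lev i ∧ x ∈ Icc (p i) (q i)} := by
    rintro _ ⟨u, hu, rfl⟩
    refine ⟨hh u hu.1 0, hu.2, fun N => ?_⟩
    obtain ⟨-, -, -, -, ⟨i, hi, h5, h6⟩, -⟩ :=
      hnext N (cell N u) (hgood N u hu.1).1 u (hgood N u hu.1).2
    refine ⟨i, hi, ?_⟩
    rw [← h5, ← h6, ← hcellS]
    exact hh u hu.1 (N + 1)
  refine le_trans ?_ (dimH_mono hsub)
  set g := Function.invFunOn h A with hg
  have hgl : ∀ u ∈ A, g (h u) = u := fun u hu =>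
    (hinj.mono hAsub).leftInvOn_invFunOn hu
  have hgA : g '' (h '' A) = A := by
    rw [image_image]
    exact (image_congr hgl).trans (image_id' A)
  have hgh : HolderOnWith 80 t.toNNReal g (h '' A) := by
    rintro _ ⟨u, hu, rfl⟩ _ ⟨v, hv, rfl⟩
    rw [hgl u hu, hgl v hv, edist_dist, edist_dist, Real.dist_eq, Real.dist_eq,
      Real.coe_toNNReal t ht.le, ENNReal.ofReal_rpow_of_nonneg (abs_nonneg _) ht.le]
    have := ENNReal.ofReal_le_ofReal (hholder u hu.1 v hv.1)
    rw [ENNReal.ofReal_mul (by norm_num)] at this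
    simpa using this
  have hfin := hgh.dimH_image_le (Real.toNNReal_pos.2 ht)
  rw [hgA, hAdim] at hfin
  have ht0 : ((t.toNNReal : NNReal) : ENNReal) ≠ 0 := by
    simpa using ht
  rw [ENNReal.le_div_iff_mul_le (Or.inl ht0) (Or.inl ENNReal.coe_ne_top), one_mul] at hfin
  exact hfin

end Ubiquity

/-- Inverse branches of the iterates of the Gauss map: `[k₁, …, kₙ]` encodes the continued fraction
with digits `k₁ + 1, …, kₙ + 1` and tail `z`. -/
noncomputable def gaussBranch : List ℕ → ℝ → ℝ
  | [], z => z
  | k :: w, z => ((k : ℝ) + 1 + gaussBranch w z)⁻¹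

/-- The product of the points `T^l x`, `l < n`, of the orbit of `x = gaussBranch w z`, where `n` is
the length of `w`. Its square is `|(T^n)' x|⁻¹`. -/
noncomputable def gaussWeight : List ℕ → ℝ → ℝ
  | [], _ => 1
  | k :: w, z => gaussBranch (k :: w) z * gaussWeight w z

theorem gaussBranch_cons (k : ℕ) (w : List ℕ) (z : ℝ) :
    gaussBranch (k :: w) z = ((k : ℝ) + 1 + gaussBranch w z)⁻¹ := rfl

theorem gaussWeight_cons (k : ℕ) (w : List ℕ) (z : ℝ) :
    gaussWeight (k :: w) z = gaussBranch (k :: w) z * gaussWeight w z := rfl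

theorem gaussBranch_mem (w : List ℕ) {z : ℝ} (hz : z ∈ Icc (0 : ℝ) 1) :
    gaussBranch w z ∈ Icc (0 : ℝ) 1 := by
  induction w with
  | nil => exact hz
  | cons k w ih =>
    rw [gaussBranch_cons]
    have : (0 : ℝ) ≤ k := k.cast_nonneg
    exact ⟨by have := ih.1; positivity, inv_le_one_of_one_le₀ (by linarith [ih.1])⟩

theorem gaussBranch_cons_pos (k : ℕ) (w : List ℕ) {z : ℝ} (hz : z ∈ Icc (0 : ℝ) 1) :
    0 < gaussBranch (k :: w) z := by
  have := (gaussBranch_mem w hz).1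
  rw [gaussBranch_cons]
  positivity

theorem gaussWeight_pos (w : List ℕ) {z : ℝ} (hz : z ∈ Icc (0 : ℝ) 1) : 0 < gaussWeight w z := by
  induction w with
  | nil => exact one_pos
  | cons k w ih => exact mul_pos (gaussBranch_cons_pos k w hz) ih

theorem gaussWeight_le_one (w : List ℕ) {z : ℝ} (hz : z ∈ Icc (0 : ℝ) 1) :
    gaussWeight w z ≤ 1 := by
  induction w with
  | nil => exact le_rfl
  | cons k w ih =>
    exact mul_le_one₀ (gaussBranch_mem (k :: w) hz).2 (gaussWeight_pos w hz).le ih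

theorem abs_gaussBranch_sub (w : List ℕ) {z z' : ℝ} (hz : z ∈ Icc (0 : ℝ) 1)
    (hz' : z' ∈ Icc (0 : ℝ) 1) :
    |gaussBranch w z - gaussBranch w z'| = |z - z'| * (gaussWeight w z * gaussWeight w z') := by
  induction w with
  | nil => simp [gaussBranch, gaussWeight]
  | cons k w ih =>
    have h1 := gaussBranch_cons_pos k w hz
    have h2 := gaussBranch_cons_pos k w hz'
    have h3 := (gaussBranch_mem w hz).1
    have h4 := (gaussBranch_mem w hz').1
    have key : gaussBranch (k :: w) z - gaussBranch (k :: w) z' =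
        -(gaussBranch w z - gaussBranch w z') *
          (gaussBranch (k :: w) z * gaussBranch (k :: w) z') := by
      rw [gaussBranch_cons, gaussBranch_cons]
      have h5 : (k : ℝ) + 1 + gaussBranch w z ≠ 0 := by positivity
      have h6 : (k : ℝ) + 1 + gaussBranch w z' ≠ 0 := by positivity
      field_simp
      ring
    rw [key, abs_mul, abs_neg, ih, abs_of_pos (mul_pos h1 h2), gaussWeight_cons,
      gaussWeight_cons]
    ring

theorem inv_gaussWeight_cons (k : ℕ) (w : List ℕ) (z : ℝ) :
    (gaussWeight (k :: w) z)⁻¹ = (k + 1 + gaussBranch w z) * (gaussWeight w z)⁻¹ := by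
  rw [gaussWeight_cons, gaussBranch_cons, mul_inv, inv_inv]

theorem gaussBranch_mul_inv_gaussWeight_cons (k : ℕ) (w : List ℕ) {z : ℝ}
    (hz : z ∈ Icc (0 : ℝ) 1) :
    gaussBranch (k :: w) z * (gaussWeight (k :: w) z)⁻¹ = (gaussWeight w z)⁻¹ := by
  have := (gaussBranch_cons_pos k w hz).ne'
  rw [gaussWeight_cons, mul_inv, mul_inv_cancel_left₀ this]

/-- Bounded distortion. -/
theorem gaussWeight_le_two_mul (w : List ℕ) {z z' : ℝ} (hz : z ∈ Icc (0 : ℝ) 1)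
    (hz' : z' ∈ Icc (0 : ℝ) 1) : gaussWeight w z' ≤ 2 * gaussWeight w z := by
  have h : (gaussWeight w z)⁻¹ ≤ 2 * (gaussWeight w z')⁻¹ ∧
      (gaussWeight w z)⁻¹ + gaussBranch w z * (gaussWeight w z)⁻¹ ≤
        2 * ((gaussWeight w z')⁻¹ + gaussBranch w z' * (gaussWeight w z')⁻¹) := by
    induction w with
    | nil =>
      simp only [gaussWeight, gaussBranch]
      constructor <;> linarith [hz.2, hz'.1]
    | cons k w ih =>
      rw [gaussBranch_mul_inv_gaussWeight_cons k w hz,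
        gaussBranch_mul_inv_gaussWeight_cons k w hz', inv_gaussWeight_cons,
        inv_gaussWeight_cons]
      have := mul_le_mul_of_nonneg_left ih.1 (k.cast_nonneg (α := ℝ))
      constructor <;> linarith [ih.1, ih.2]
  have h1 := gaussWeight_pos w hz
  have h2 := gaussWeight_pos w hz'
  have h3 := h.1
  rw [inv_eq_one_div, inv_eq_one_div, mul_one_div, div_le_div_iff₀ h1 h2] at h3
  linarith

theorem gaussWeight_le_pow (w : List ℕ) {z : ℝ} (hz : z ∈ Icc (0 : ℝ) 1) :
    gaussWeight w z ≤ 3 / 2 * (2 / 3) ^ w.length := by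
  have h : 2 * (3 / 2 : ℝ) ^ w.length ≤
      2 * (gaussWeight w z)⁻¹ + gaussBranch w z * (gaussWeight w z)⁻¹ := by
    induction w with
    | nil =>
      simp only [gaussWeight, gaussBranch, List.length_nil]
      linarith [hz.1]
    | cons k w ih =>
      rw [gaussBranch_mul_inv_gaussWeight_cons k w hz, inv_gaussWeight_cons, List.length_cons,
        pow_succ]
      have h1 := inv_pos.2 (gaussWeight_pos w hz)
      have h2 := mul_nonneg (k.cast_nonneg (α := ℝ)) h1.le
      have h3 := mul_nonneg (gaussBranch_mem w hz).1 h1.le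
      linarith
  have h1 := inv_pos.2 (gaussWeight_pos w hz)
  have h2 := mul_le_mul_of_nonneg_right (gaussBranch_mem w hz).2 h1.le
  have h3 : 2 / 3 * (3 / 2 : ℝ) ^ w.length ≤ (gaussWeight w z)⁻¹ := by linarith
  calc gaussWeight w z ≤ (2 / 3 * (3 / 2 : ℝ) ^ w.length)⁻¹ := by
        rw [le_inv_comm₀ (gaussWeight_pos w hz) (by positivity)]
        exact h3
    _ = 3 / 2 * (2 / 3) ^ w.length := by
        rw [mul_inv, ← inv_pow]; norm_num

theorem irrational_gaussBranch_iff (w : List ℕ) {z : ℝ} :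
    Irrational (gaussBranch w z) ↔ Irrational z := by
  induction w with
  | nil => rfl
  | cons k w ih =>
    rw [gaussBranch_cons, irrational_inv_iff, ← ih]
    have := irrational_natCast_add_iff (n := k + 1) (x := gaussBranch w z)
    push_cast at this
    exact this

theorem gaussBranch_mem_repeller (w : List ℕ) {z : ℝ} (hz : z ∈ gaussRepeller) :
    gaussBranch w z ∈ gaussRepeller :=
  ⟨gaussBranch_mem w hz.1, (irrational_gaussBranch_iff w).2 hz.2⟩

theorem gaussRepeller_pos {z : ℝ} (hz : z ∈ gaussRepeller) : 0 < z :=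
  lt_of_le_of_ne hz.1.1 fun h => hz.2.ne_zero h.symm

theorem gaussRepeller_lt_one {z : ℝ} (hz : z ∈ gaussRepeller) : z < 1 :=
  lt_of_le_of_ne hz.1.2 hz.2.ne_one

theorem gaussMap_inv_add (k : ℕ) {x : ℝ} (hx : x ∈ gaussRepeller) :
    gaussMap ((k : ℝ) + 1 + x)⁻¹ = x := by
  have h0 := gaussRepeller_pos hx
  have h1 : ((k : ℝ) + 1 + x)⁻¹ ≠ 0 := by positivity
  rw [gaussMap, if_neg h1, inv_inv, Int.fract_eq_iff]
  exact ⟨h0.le, gaussRepeller_lt_one hx, k + 1, by push_cast; ring⟩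

theorem gaussMap_gaussBranch_cons (k : ℕ) (w : List ℕ) {z : ℝ} (hz : z ∈ gaussRepeller) :
    gaussMap (gaussBranch (k :: w) z) = gaussBranch w z :=
  gaussMap_inv_add k (gaussBranch_mem_repeller w hz)

theorem iterate_gaussMap_gaussBranch (w : List ℕ) {z : ℝ} (hz : z ∈ gaussRepeller) :
    gaussMap^[w.length] (gaussBranch w z) = z := by
  induction w with
  | nil => rfl
  | cons k w ih =>
    rw [List.length_cons, Function.iterate_succ_apply, gaussMap_gaussBranch_cons k w hz, ih]

theorem exists_eq_inv_add {x : ℝ} (hx : x ∈ gaussRepeller) :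
    ∃ k : ℕ, ∃ x' ∈ gaussRepeller, x = ((k : ℝ) + 1 + x')⁻¹ := by
  have h0 := gaussRepeller_pos hx
  have h1 : 1 ≤ ⌊x⁻¹⌋₊ := Nat.le_floor (by
    rw [Nat.cast_one]; exact (one_le_inv₀ h0).2 hx.1.2)
  obtain ⟨k, hk⟩ := Nat.exists_eq_add_of_le' h1
  have h2 := Nat.floor_le (inv_pos.2 h0).le
  have h3 := Nat.lt_floor_add_one x⁻¹
  have hirr : Irrational (x⁻¹ - (⌊x⁻¹⌋₊ : ℝ)) := by
    rw [irrational_sub_natCast_iff, irrational_inv_iff]; exact hx.2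
  refine ⟨k, x⁻¹ - (⌊x⁻¹⌋₊ : ℝ), ⟨⟨by linarith, by linarith⟩, hirr⟩, ?_⟩
  rw [hk]
  push_cast
  rw [add_sub_cancel, inv_inv]

theorem exists_eq_gaussBranch (n : ℕ) {x : ℝ} (hx : x ∈ gaussRepeller) :
    ∃ w : List ℕ, w.length = n ∧ ∃ z ∈ gaussRepeller, x = gaussBranch w z := by
  induction n generalizing x with
  | zero => exact ⟨[], rfl, x, hx, rfl⟩
  | succ n ih =>
    obtain ⟨k, x', hx', rfl⟩ := exists_eq_inv_add hx
    obtain ⟨w, hw, z, hz, rfl⟩ := ih hx'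
    exact ⟨k :: w, by simp [hw], z, hz, rfl⟩

theorem gaussBranch_inj {w w' : List ℕ} (hlen : w.length = w'.length) {z z' : ℝ}
    (hz : z ∈ gaussRepeller) (hz' : z' ∈ gaussRepeller)
    (h : gaussBranch w z = gaussBranch w' z') : w = w' := by
  induction w generalizing w' with
  | nil => exact (List.length_eq_zero_iff.1 hlen.symm).symm
  | cons k w ih =>
    obtain _ | ⟨k', w'⟩ := w'
    · simp at hlen
    have hT := congrArg gaussMap h
    rw [gaussMap_gaussBranch_cons k w hz, gaussMap_gaussBranch_cons k' w' hz'] at hT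
    rw [gaussBranch_cons, gaussBranch_cons, inv_inj, hT, add_left_inj, add_left_inj,
      Nat.cast_inj] at h
    rw [h, ih (by simpa using hlen) hT]

theorem gaussPsi_eq {x : ℝ} (hx : x ∈ gaussRepeller) : gaussPsi x = -2 * Real.log x := by
  have h0 := gaussRepeller_pos hx
  obtain ⟨k, x', hx', rfl⟩ := exists_eq_inv_add hx
  set x := ((k : ℝ) + 1 + x')⁻¹ with hxdef
  have hinv : x⁻¹ = (k : ℝ) + 1 + x' := by rw [hxdef, inv_inv]
  have hev : gaussMap =ᶠ[𝓝 x] fun t => t⁻¹ - ((k : ℝ) + 1) := by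
    have hc : ContinuousAt (fun t : ℝ => t⁻¹) x := continuousAt_inv₀ h0.ne'
    have hmem : Ioo ((k : ℝ) + 1) (k + 1 + 1) ∈ 𝓝 x⁻¹ := by
      rw [hinv]
      exact Ioo_mem_nhds (by linarith [gaussRepeller_pos hx'])
        (by linarith [gaussRepeller_lt_one hx'])
    filter_upwards [hc hmem, Ioi_mem_nhds h0] with t ht ht0
    have ht' : t⁻¹ ∈ Ioo ((k : ℝ) + 1) (k + 1 + 1) := ht
    rw [gaussMap, if_neg (ne_of_gt ht0), Int.fract_eq_iff]
    exact ⟨by linarith [ht'.1], by linarith [ht'.2], k + 1, by push_cast; ring⟩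
  have hd : HasDerivAt (fun t : ℝ => t⁻¹ - ((k : ℝ) + 1)) (-(x ^ 2)⁻¹) x :=
    (hasDerivAt_inv h0.ne').sub_const _
  rw [gaussPsi, hev.deriv_eq, hd.deriv, abs_neg, Real.log_abs, Real.log_inv, Real.log_pow]
  push_cast
  ring

theorem gaussBirkhoff_gaussBranch (c : ℝ) (w : List ℕ) {z : ℝ} (hz : z ∈ gaussRepeller) :
    gaussBirkhoff (fun x => c * gaussPsi x) w.length (gaussBranch w z) =
      -(2 * c) * Real.log (gaussWeight w z) := by
  induction w with
  | nil => simp [gaussBirkhoff, gaussWeight]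
  | cons k w ih =>
    unfold gaussBirkhoff at ih ⊢
    rw [List.length_cons, Finset.sum_range_succ']
    simp only [Function.iterate_succ_apply, gaussMap_gaussBranch_cons k w hz,
      Function.iterate_zero, id_eq]
    rw [ih, gaussPsi_eq (gaussBranch_mem_repeller _ hz), gaussWeight_cons,
      Real.log_mul (gaussBranch_cons_pos k w hz.1).ne' (gaussWeight_pos w hz.1).ne']
    ring

theorem exp_neg_gaussBirkhoff (α : ℝ) (w : List ℕ) {z : ℝ} (hz : z ∈ gaussRepeller) :
    Real.exp (-(gaussBirkhoff (fun x => (α / 2 - 1) * gaussPsi x) w.length (gaussBranch w z))) =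
      gaussWeight w z ^ (α - 2) := by
  rw [gaussBirkhoff_gaussBranch _ w hz, Real.rpow_def_of_pos (gaussWeight_pos w hz.1)]
  congr 1
  ring

/-- The length of the cylinder coded by `w`. -/
noncomputable def cylinderLength (w : List ℕ) : ℝ := gaussWeight w 0 * gaussWeight w 1

theorem zero_mem_unit : (0 : ℝ) ∈ Icc (0 : ℝ) 1 := ⟨le_rfl, zero_le_one⟩

theorem one_mem_unit : (1 : ℝ) ∈ Icc (0 : ℝ) 1 := ⟨zero_le_one, le_rfl⟩

theorem cylinderLength_pos (w : List ℕ) : 0 < cylinderLength w :=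
  mul_pos (gaussWeight_pos w zero_mem_unit) (gaussWeight_pos w one_mem_unit)

theorem cylinderLength_le_one (w : List ℕ) : cylinderLength w ≤ 1 :=
  mul_le_one₀ (gaussWeight_le_one w zero_mem_unit) (gaussWeight_pos w one_mem_unit).le
    (gaussWeight_le_one w one_mem_unit)

theorem cylinderLength_le_pow (w : List ℕ) :
    cylinderLength w ≤ 3 / 2 * (2 / 3) ^ w.length :=
  (mul_le_of_le_one_right (gaussWeight_pos w zero_mem_unit).le
    (gaussWeight_le_one w one_mem_unit)).trans (gaussWeight_le_pow w zero_mem_unit)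

theorem gaussWeight_mul_le (w : List ℕ) {z z' : ℝ} (hz : z ∈ Icc (0 : ℝ) 1)
    (hz' : z' ∈ Icc (0 : ℝ) 1) : gaussWeight w z * gaussWeight w z' ≤ 4 * cylinderLength w := by
  have h := mul_le_mul (gaussWeight_le_two_mul w zero_mem_unit hz)
    (gaussWeight_le_two_mul w one_mem_unit hz') (gaussWeight_pos w hz').le
    (by have := gaussWeight_pos w zero_mem_unit; positivity)
  unfold cylinderLength
  linarith

theorem cylinderLength_le_mul (w : List ℕ) {z z' : ℝ} (hz : z ∈ Icc (0 : ℝ) 1)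
    (hz' : z' ∈ Icc (0 : ℝ) 1) : cylinderLength w ≤ 4 * (gaussWeight w z * gaussWeight w z') := by
  have h := mul_le_mul (gaussWeight_le_two_mul w hz zero_mem_unit)
    (gaussWeight_le_two_mul w hz' one_mem_unit) (gaussWeight_pos w one_mem_unit).le
    (by have := gaussWeight_pos w hz; positivity)
  unfold cylinderLength
  linarith

theorem gaussWeight_rpow (w : List ℕ) (s : ℝ) {z : ℝ} (hz : z ∈ Icc (0 : ℝ) 1) :
    gaussWeight w z ^ s = (gaussWeight w z * gaussWeight w z) ^ (s / 2) := by
  have := (gaussWeight_pos w hz).le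
  rw [Real.mul_rpow this this, ← Real.rpow_add (gaussWeight_pos w hz), add_halves]

theorem continuousOn_gaussBranch (w : List ℕ) : ContinuousOn (gaussBranch w) (Icc 0 1) := by
  refine (LipschitzOnWith.of_dist_le_mul (K := 1) fun z hz z' hz' => ?_).continuousOn
  rw [Real.dist_eq, Real.dist_eq, abs_gaussBranch_sub w hz hz', NNReal.coe_one, one_mul]
  exact mul_le_of_le_one_right (abs_nonneg _)
    (mul_le_one₀ (gaussWeight_le_one w hz) (gaussWeight_pos w hz').le (gaussWeight_le_one w hz'))

theorem exists_gaussBranch_eq_of_mem_uIcc (w : List ℕ) {a b x : ℝ} (ha : a ∈ Icc (0 : ℝ) 1)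
    (hb : b ∈ Icc (0 : ℝ) 1) (hx : x ∈ uIcc (gaussBranch w a) (gaussBranch w b))
    (hirr : Irrational x) : ∃ z ∈ uIcc a b, z ∈ gaussRepeller ∧ gaussBranch w z = x := by
  have hsub : uIcc a b ⊆ Icc 0 1 := uIcc_subset_Icc ha hb
  obtain ⟨z, hz, rfl⟩ := intermediate_value_uIcc ((continuousOn_gaussBranch w).mono hsub) hx
  exact ⟨z, hz, ⟨hsub hz, (irrational_gaussBranch_iff w).1 hirr⟩, rfl⟩

/-- The part of the `n`-th target set inside the cylinder coded by `w`, where `n` is the length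
of `w`. -/
def targetPiece (α y : ℝ) (w : List ℕ) : Set ℝ :=
  {x | ∃ z ∈ gaussRepeller, gaussBranch w z = x ∧ |z - y| < gaussWeight w z ^ (α - 2)}

theorem mem_gaussTarget_iff {α y x : ℝ} :
    x ∈ gaussTarget y (fun x => (α / 2 - 1) * gaussPsi x) ↔
      ∀ m, ∃ w : List ℕ, m ≤ w.length ∧ x ∈ targetPiece α y w := by
  simp only [gaussTarget, mem_iInter, mem_iUnion, mem_ofPred_eq, exists_prop]
  refine forall_congr' fun m => ⟨?_, ?_⟩
  · rintro ⟨n, hmn, hx, hlt⟩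
    obtain ⟨w, rfl, z, hz, rfl⟩ := exists_eq_gaussBranch n hx
    rw [iterate_gaussMap_gaussBranch w hz, exp_neg_gaussBirkhoff α w hz] at hlt
    exact ⟨w, hmn, z, hz, rfl, hlt⟩
  · rintro ⟨w, hmw, z, hz, rfl, hlt⟩
    refine ⟨w.length, hmw, gaussBranch_mem_repeller w hz, ?_⟩
    rwa [iterate_gaussMap_gaussBranch w hz, exp_neg_gaussBirkhoff α w hz]

theorem ediam_targetPiece_le {α : ℝ} (hα : 2 < α) (y : ℝ) (w : List ℕ) :
    Metric.ediam (targetPiece α y w) ≤ ENNReal.ofReal (2 * (4 * cylinderLength w) ^ (α / 2)) := by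
  have hl := cylinderLength_pos w
  have hW : ∀ z ∈ Icc (0 : ℝ) 1,
      gaussWeight w z ^ (α - 2) ≤ (4 * cylinderLength w) ^ ((α - 2) / 2) := fun z hz => by
    rw [gaussWeight_rpow w _ hz]
    exact Real.rpow_le_rpow (mul_self_nonneg _) (gaussWeight_mul_le w hz hz) (by linarith)
  refine Metric.ediam_le ?_
  rintro _ ⟨z, hz, rfl, hlt⟩ _ ⟨z', hz', rfl, hlt'⟩
  rw [edist_dist, Real.dist_eq, abs_gaussBranch_sub w hz.1 hz'.1]
  refine ENNReal.ofReal_le_ofReal ?_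
  have h1 : |z - z'| ≤ 2 * (4 * cylinderLength w) ^ ((α - 2) / 2) := by
    have := abs_sub_le z y z'
    rw [abs_sub_comm y] at this
    linarith [hW z hz.1, hW z' hz'.1]
  have h2 := gaussWeight_mul_le w hz.1 hz'.1
  calc |z - z'| * (gaussWeight w z * gaussWeight w z')
      ≤ (2 * (4 * cylinderLength w) ^ ((α - 2) / 2)) * (4 * cylinderLength w) :=
        mul_le_mul h1 h2 (mul_pos (gaussWeight_pos w hz.1) (gaussWeight_pos w hz'.1)).le
          (by positivity)
    _ = 2 * (4 * cylinderLength w) ^ (α / 2) := by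
        rw [mul_assoc, ← Real.rpow_add_one (by positivity)]
        congr 2
        ring

open MeasureTheory in
theorem tsum_cylinderLength_le_one (n : ℕ) :
    ∑' w : {w : List ℕ // w.length = n}, ENNReal.ofReal (cylinderLength w) ≤ 1 := by
  set A : {w : List ℕ // w.length = n} → Set ℝ := fun w =>
    uIcc (gaussBranch w 0) (gaussBranch w 1) \ range ((↑) : ℚ → ℝ) with hA
  have hvol : ∀ w, volume (A w) = ENNReal.ofReal (cylinderLength w) := by
    intro w
    rw [hA, measure_sdiff_null ((countable_range _).measure_zero volume), Real.volume_interval,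
      abs_gaussBranch_sub _ one_mem_unit zero_mem_unit, cylinderLength]
    simp [mul_comm]
  have hrep : ∀ w, ∀ x ∈ A w, ∃ z ∈ gaussRepeller, gaussBranch w z = x := by
    rintro w x ⟨hx, hirr⟩
    obtain ⟨z, -, hz, h⟩ :=
      exists_gaussBranch_eq_of_mem_uIcc w zero_mem_unit one_mem_unit hx hirr
    exact ⟨z, hz, h⟩
  have hdis : Pairwise (Function.onFun Disjoint A) := by
    intro w w' hne
    refine disjoint_left.2 fun x hx hx' => hne ?_
    obtain ⟨z, hz, rfl⟩ := hrep w x hx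
    obtain ⟨z', hz', h⟩ := hrep w' _ hx'
    exact Subtype.ext (gaussBranch_inj (w.2.trans w'.2.symm) hz hz' h.symm)
  have hsub : (⋃ w, A w) ⊆ Icc 0 1 := by
    refine iUnion_subset fun w x hx => ?_
    obtain ⟨z, hz, rfl⟩ := hrep w x hx
    exact gaussBranch_mem w hz.1
  have := measure_mono (μ := volume) hsub
  rw [measure_iUnion hdis fun w =>
    measurableSet_uIcc.diff (countable_range _).measurableSet] at this
  simpa [hvol] using this

theorem tsum_cylinderLength_rpow_ne_top {ε : ℝ} (hε : 0 < ε) :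
    ∑' w : List ℕ, ENNReal.ofReal (cylinderLength w ^ (1 + ε)) ≠ ⊤ := by
  set θ : ℝ := (2 / 3 : ℝ) ^ ε with hθ
  have hθ0 : 0 ≤ θ := by positivity
  have hθ1 : θ < 1 := Real.rpow_lt_one (by norm_num) (by norm_num) hε
  have hbound : ∀ w : List ℕ, ENNReal.ofReal (cylinderLength w ^ (1 + ε)) ≤
      ENNReal.ofReal ((3 / 2) ^ ε * θ ^ w.length) * ENNReal.ofReal (cylinderLength w) := by
    intro w
    have hl := cylinderLength_pos w
    rw [← ENNReal.ofReal_mul (by positivity), Real.rpow_add hl, Real.rpow_one, mul_comm]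
    refine ENNReal.ofReal_le_ofReal (mul_le_mul_of_nonneg_right ?_ hl.le)
    calc cylinderLength w ^ ε ≤ (3 / 2 * (2 / 3) ^ w.length) ^ ε :=
          Real.rpow_le_rpow hl.le (cylinderLength_le_pow w) hε.le
      _ = (3 / 2) ^ ε * θ ^ w.length := by
          rw [Real.mul_rpow (by norm_num) (by positivity), hθ, ← Real.rpow_natCast,
            ← Real.rpow_natCast, ← Real.rpow_mul (by norm_num), ← Real.rpow_mul (by norm_num),
            mul_comm ε]
  have hsum : Summable fun n : ℕ => (3 / 2 : ℝ) ^ ε * θ ^ n :=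
    (summable_geometric_of_lt_one hθ0 hθ1).mul_left _
  refine ne_top_of_le_ne_top hsum.tsum_ofReal_ne_top ?_
  rw [← (Equiv.sigmaFiberEquiv (List.length (α := ℕ))).tsum_eq, ENNReal.tsum_sigma']
  refine ENNReal.tsum_le_tsum fun n => ?_
  calc ∑' w : {w : List ℕ // w.length = n}, ENNReal.ofReal (cylinderLength w ^ (1 + ε))
      ≤ ∑' w : {w : List ℕ // w.length = n},
          ENNReal.ofReal ((3 / 2) ^ ε * θ ^ n) * ENNReal.ofReal (cylinderLength w) :=
        ENNReal.tsum_le_tsum fun w => by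
          have := hbound w
          rwa [w.2] at this
    _ ≤ ENNReal.ofReal ((3 / 2) ^ ε * θ ^ n) * 1 := by
        rw [ENNReal.tsum_mul_left]
        exact mul_le_mul_right (tsum_cylinderLength_le_one n) _
    _ = _ := mul_one _

open MeasureTheory MeasureTheory.Measure in
/-- The convergence part of the Hausdorff–Cantelli lemma. -/
theorem dimH_le_of_tsum_ediam_ne_top {X ι : Type*} [EMetricSpace X] [Countable ι]
    {A : ι → Set X} {s : Set X} {d : ℝ} (hd : 0 < d)
    (hs : ∀ F : Finset ι, s ⊆ ⋃ i : {i // i ∉ F}, A i)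
    (hsum : ∑' i, Metric.ediam (A i) ^ d ≠ ⊤) : dimH s ≤ ENNReal.ofReal d := by
  borelize X
  have htail := ENNReal.tendsto_tsum_compl_atTop_zero hsum
  have hr : Tendsto (fun F : Finset ι =>
      (∑' i : {i // i ∉ F}, Metric.ediam (A i) ^ d) ^ (1 / d)) atTop (𝓝 0) := by
    have h := ((ENNReal.continuous_rpow_const (y := 1 / d)).tendsto 0).comp htail
    rwa [ENNReal.zero_rpow_of_pos (one_div_pos.2 hd)] at h
  have hle := hausdorffMeasure_le_liminf_tsum (ι := fun F : Finset ι => {i // i ∉ F}) d s _ hr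
    (fun F i => A i) (Eventually.of_forall fun F i => ?_) (Eventually.of_forall hs)
  · rw [htail.liminf_eq] at hle
    refine dimH_le_of_hausdorffMeasure_ne_top (d := d.toNNReal) ?_
    rw [Real.coe_toNNReal d hd.le, le_zero_iff.1 hle]
    exact ENNReal.zero_ne_top
  · rw [one_div, ENNReal.le_rpow_inv_iff hd]
    exact ENNReal.le_tsum (f := fun i : {i // i ∉ F} => Metric.ediam (A i) ^ d) i

theorem dimH_gaussTarget_le {α : ℝ} (hα : 2 < α) (y : ℝ) :
    dimH (gaussTarget y (fun x => (α / 2 - 1) * gaussPsi x)) ≤ ENNReal.ofReal (2 / α) := by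
  have hα0 : 0 < α := by linarith
  have hlim : Tendsto (fun ε : ℝ => ENNReal.ofReal (2 / α * (1 + ε))) (𝓝[>] 0)
      (𝓝 (ENNReal.ofReal (2 / α))) := by
    have : Continuous fun ε : ℝ => ENNReal.ofReal (2 / α * (1 + ε)) :=
      ENNReal.continuous_ofReal.comp (by fun_prop)
    simpa using (this.tendsto 0).mono_left (nhdsWithin_le_nhds (s := Ioi 0))
  refine ge_of_tendsto hlim (eventually_nhdsWithin_of_forall fun ε hε => ?_)
  have hε : 0 < ε := hε
  set d := 2 / α * (1 + ε) with hd
  have hd0 : 0 < d := by positivity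
  refine dimH_le_of_tsum_ediam_ne_top (A := targetPiece α y) hd0 (fun F x hx => ?_) ?_
  · obtain ⟨w, hw, hxw⟩ := mem_gaussTarget_iff.1 hx (F.sup List.length + 1)
    refine mem_iUnion.2 ⟨⟨w, fun hwF => ?_⟩, hxw⟩
    have := Finset.le_sup (f := List.length) hwF
    omega
  · have hle : ∀ w : List ℕ, Metric.ediam (targetPiece α y w) ^ d ≤
        ENNReal.ofReal (2 ^ d * 4 ^ (1 + ε)) *
          ENNReal.ofReal (cylinderLength w ^ (1 + ε)) := by
      intro w
      have hl := cylinderLength_pos w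
      calc Metric.ediam (targetPiece α y w) ^ d
          ≤ ENNReal.ofReal (2 * (4 * cylinderLength w) ^ (α / 2)) ^ d :=
            ENNReal.rpow_le_rpow (ediam_targetPiece_le hα y w) hd0.le
        _ = ENNReal.ofReal ((2 * (4 * cylinderLength w) ^ (α / 2)) ^ d) :=
            ENNReal.ofReal_rpow_of_nonneg (by positivity) hd0.le
        _ = _ := by
            rw [← ENNReal.ofReal_mul (by positivity), Real.mul_rpow (by norm_num) (by positivity),
              ← Real.rpow_mul (by positivity),
              show α / 2 * d = 1 + ε by rw [hd]; field_simp,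
              Real.mul_rpow (by norm_num) hl.le, mul_assoc]
    refine ne_top_of_le_ne_top ?_ (ENNReal.tsum_le_tsum hle)
    rw [ENNReal.tsum_mul_left]
    exact ENNReal.mul_ne_top ENNReal.ofReal_ne_top (tsum_cylinderLength_rpow_ne_top hε)

theorem exists_interval_near {y η : ℝ} (hy : y ∈ Icc (0 : ℝ) 1) (hη : 0 ≤ η) (hη2 : η ≤ 1 / 2) :
    ∃ a ∈ Icc (0 : ℝ) 1, ∃ b ∈ Icc (0 : ℝ) 1, |a - b| = η ∧ ∀ z ∈ uIcc a b, |z - y| ≤ η := by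
  rcases le_total y (1 / 2) with h | h
  · refine ⟨y, hy, y + η, ⟨by linarith [hy.1], by linarith⟩, ?_, fun z hz => ?_⟩
    · rw [sub_add_cancel_left, abs_neg, abs_of_nonneg hη]
    · rw [uIcc_of_le (by linarith)] at hz
      rw [abs_le]
      constructor <;> linarith [hz.1, hz.2]
  · refine ⟨y - η, ⟨by linarith, by linarith [hy.2]⟩, y, hy, ?_, fun z hz => ?_⟩
    · rw [sub_sub_cancel_left, abs_neg, abs_of_nonneg hη]
    · rw [uIcc_of_le (by linarith)] at hz
      rw [abs_le]
      constructor <;> linarith [hz.1, hz.2]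

theorem le_dimH_gaussTarget {α : ℝ} (hα : 2 < α) {y : ℝ} (hy : y ∈ Icc (0 : ℝ) 1) {t : ℝ}
    (ht : 0 < t) (htα : t < 2 / α) :
    ENNReal.ofReal t ≤ dimH (gaussTarget y (fun x => (α / 2 - 1) * gaussPsi x)) := by
  have hα0 : 0 < α := by linarith
  set η : List ℕ → ℝ := fun w => 1 / 2 * (cylinderLength w / 4) ^ ((α - 2) / 2) with hη
  have hη0 : ∀ w, 0 < η w := fun w => by
    have := cylinderLength_pos w
    positivity
  have hη2 : ∀ w, η w ≤ 1 / 2 := fun w => by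
    have h1 := cylinderLength_pos w
    have h2 := cylinderLength_le_one w
    have := Real.rpow_le_one (x := cylinderLength w / 4) (z := (α - 2) / 2) (by positivity)
      (by linarith) (by linarith)
    simp only [hη]
    linarith
  choose a ha b hb hab hnear using fun w => exists_interval_near hy (hη0 w).le (hη2 w)
  have hclose : ∀ w, ∀ z ∈ uIcc (a w) (b w),
      |gaussBranch w z - gaussBranch w y| ≤ 4 * cylinderLength w / 2 := by
    intro w z hz
    have hz01 := uIcc_subset_Icc (ha w) (hb w) hz
    rw [abs_gaussBranch_sub w hz01 hy]
    have := mul_le_mul ((hnear w z hz).trans (hη2 w)) (gaussWeight_mul_le w hz01 hy)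
      (mul_pos (gaussWeight_pos w hz01) (gaussWeight_pos w hy)).le (by norm_num)
    linarith
  have hmain := le_dimH_of_ubiquity (ι := List ℕ) (z := fun w => gaussBranch w y)
    (r := fun w => 4 * cylinderLength w) (lev := List.length)
    (p := fun w => min (gaussBranch w (a w)) (gaussBranch w (b w)))
    (q := fun w => max (gaussBranch w (a w)) (gaussBranch w (b w)))
    (β := α / 2) (C := 1 / 2 * (1 / 16) ^ (α / 2)) (t := t) (by positivity) ht
    (htα.le.trans ((div_le_one hα0).2 hα.le)) (by rw [lt_div_iff₀ hα0] at htα; linarith)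
    (fun w => mul_pos (by norm_num) (cylinderLength_pos w)) ?_ ?_ ?_ ?_
  · refine hmain.trans (dimH_mono ?_)
    rintro x ⟨-, hirr, hx⟩
    rw [mem_gaussTarget_iff]
    intro m
    obtain ⟨w, hw, hxw⟩ := hx m
    obtain ⟨z, hz, hzr, rfl⟩ := exists_gaussBranch_eq_of_mem_uIcc w (ha w) (hb w) hxw hirr
    refine ⟨w, hw, z, hzr, rfl, (hnear w z hz).trans_lt ?_⟩
    have hl := cylinderLength_pos w
    have h1 : (cylinderLength w / 4) ^ ((α - 2) / 2) ≤ gaussWeight w z ^ (α - 2) := by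
      rw [gaussWeight_rpow w _ hzr.1]
      exact Real.rpow_le_rpow (by positivity)
        (by linarith [cylinderLength_le_mul w hzr.1 hzr.1]) (by linarith)
    have h2 : 0 < (cylinderLength w / 4) ^ ((α - 2) / 2) := by positivity
    simp only [hη]
    linarith
  · intro w
    rcases min_choice (gaussBranch w (a w)) (gaussBranch w (b w)) with h | h <;> simp only [h]
    · linarith [(abs_le.1 (hclose w _ left_mem_uIcc)).1]
    · linarith [(abs_le.1 (hclose w _ right_mem_uIcc)).1]
  · intro w
    rcases max_choice (gaussBranch w (a w)) (gaussBranch w (b w)) with h | h <;> simp only [h]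
    · linarith [(abs_le.1 (hclose w _ left_mem_uIcc)).2]
    · linarith [(abs_le.1 (hclose w _ right_mem_uIcc)).2]
  · intro w
    have hl := cylinderLength_pos w
    rw [max_sub_min_eq_abs', abs_gaussBranch_sub w (ha w) (hb w), hab]
    calc 1 / 2 * (1 / 16) ^ (α / 2) * (4 * cylinderLength w) ^ (α / 2)
        = 1 / 2 * (cylinderLength w / 4) ^ (α / 2) := by
          rw [mul_assoc, ← Real.mul_rpow (by norm_num) (by positivity)]
          congr 2
          ring
      _ = η w * (cylinderLength w / 4) := by
          simp only [hη]
          rw [mul_assoc, ← Real.rpow_add_one (by positivity)]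
          congr 2
          ring
      _ ≤ η w * (gaussWeight w (a w) * gaussWeight w (b w)) :=
          mul_le_mul_of_nonneg_left (by linarith [cylinderLength_le_mul w (ha w) (hb w)])
            (hη0 w).le
  · intro N δ hδ x hx hirr
    obtain ⟨n, hn⟩ := exists_pow_lt_of_lt_one (show 0 < δ / 6 by positivity)
      (show (2 / 3 : ℝ) < 1 by norm_num)
    obtain ⟨w, hw, z, hz, rfl⟩ := exists_eq_gaussBranch (max N n) ⟨hx, hirr⟩
    refine ⟨w, hw ▸ le_max_left N n, ?_, ?_⟩
    · have h1 : (2 / 3 : ℝ) ^ w.length ≤ (2 / 3) ^ n :=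
        pow_le_pow_of_le_one (by norm_num) (by norm_num) (hw ▸ le_max_right N n)
      linarith [cylinderLength_le_pow w]
    · rw [abs_gaussBranch_sub w hz.1 hy]
      have h1 : |z - y| ≤ 1 := abs_sub_le_iff.2 ⟨by linarith [hz.1.2, hy.1],
        by linarith [hz.1.1, hy.2]⟩
      have h2 := mul_le_mul h1 (gaussWeight_mul_le w hz.1 hy)
        (mul_pos (gaussWeight_pos w hz.1) (gaussWeight_pos w hy)).le zero_le_one
      linarith

/-- For all `α > 2` and every `y ∈ [0,1]`, `dim D_y(ψ_α) = 2/α` where `ψ_α = (α/2 - 1)ψ`. -/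
theorem dimH_gaussTarget_eq (α : ℝ) (hα : 2 < α) (y : ℝ) (hy : y ∈ Set.Icc (0:ℝ) 1) :
    dimH (gaussTarget y (fun x => (α / 2 - 1) * gaussPsi x)) = ENNReal.ofReal (2 / α) := by
  refine le_antisymm (dimH_gaussTarget_le hα y) ?_
  have h0 : 0 < 2 / α := by positivity
  have hlim : Tendsto (fun t : ℝ => ENNReal.ofReal t) (𝓝[<] (2 / α))
      (𝓝 (ENNReal.ofReal (2 / α))) :=
    (ENNReal.continuous_ofReal.tendsto _).mono_left nhdsWithin_le_nhds
  refine le_of_tendsto hlim ?_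
  filter_upwards [Ioo_mem_nhdsLT h0] with t ht
  exact le_dimH_gaussTarget hα hy ht.1 ht.2
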